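/- arXiv:2301.02280 — 4 statements merged into one kernel-verified Lean document; each statement's English description precedes it below -/
import Mathlib

section
/- Let f : X → ℝ be bounded measurable and τ > 0. Then ∫ exp(f/τ) dμ_β^f → exp((essSup_μ f)/τ) as β → ∞; that is, the expectation of exp(f/τ) under the exponentially tilted (hard-negative) distribution converges to the essential supremum of exp(f/τ). -/
open MeasureTheory Filter

lemma integrable_exp_mul_of_abs_le {X : Type*} [MeasurableSpace X] {μ : Measure X}
    [IsFiniteMeasure μ] {f : X → ℝ} (hf : Measurable f) {C : ℝ} (hC : ∀ x, |f x| ≤ C) (β : ℝ) :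
    Integrable (fun x => Real.exp (β * f x)) μ := by
  refine Integrable.of_bound (by fun_prop) (Real.exp (|β| * C)) (ae_of_all _ fun x => ?_)
  rw [Real.norm_eq_abs, Real.abs_exp, Real.exp_le_exp]
  calc β * f x ≤ |β * f x| := le_abs_self _
    _ = |β| * |f x| := abs_mul _ _
    _ ≤ |β| * C := by gcongr; exact hC x

lemma tilted_mul_real_le {X : Type*} [MeasurableSpace X] {μ : Measure X}
    [IsProbabilityMeasure μ] {f : X → ℝ} (hf : Measurable f) {a b β : ℝ} (hβ : 0 ≤ β)
    (hint : Integrable (fun x => Real.exp (β * f x)) μ) (hb : 0 < μ.real {x | b < f x}) :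
    (μ.tilted (fun x => β * f x)).real {x | f x ≤ a} ≤
      Real.exp (-((b - a) * β)) / μ.real {x | b < f x} := by
  have hma : MeasurableSet {x | f x ≤ a} := measurableSet_le hf measurable_const
  have hmb : MeasurableSet {x | b < f x} := measurableSet_lt measurable_const hf
  have hZ : Real.exp (β * b) * μ.real {x | b < f x} ≤ ∫ x, Real.exp (β * f x) ∂μ :=
    calc Real.exp (β * b) * μ.real {x | b < f x}
        ≤ ∫ x in {x | b < f x}, Real.exp (β * f x) ∂μ :=
          setIntegral_ge_of_const_le_real hmb (measure_ne_top _ _)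
            (fun x hx => Real.exp_le_exp.2 (mul_le_mul_of_nonneg_left (le_of_lt hx) hβ))
            hint.integrableOn
      _ ≤ ∫ x, Real.exp (β * f x) ∂μ :=
          setIntegral_le_integral hint (ae_of_all _ fun x => (Real.exp_pos _).le)
  have hA : ∫ x in {x | f x ≤ a}, Real.exp (β * f x) ∂μ ≤ Real.exp (β * a) :=
    calc ∫ x in {x | f x ≤ a}, Real.exp (β * f x) ∂μ
        ≤ ∫ _ in {x | f x ≤ a}, Real.exp (β * a) ∂μ :=
          setIntegral_mono_on hint.integrableOn (integrable_const _) hma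
            fun x hx => Real.exp_le_exp.2 (mul_le_mul_of_nonneg_left hx hβ)
      _ ≤ Real.exp (β * a) := by
          rw [setIntegral_const, smul_eq_mul]
          exact mul_le_of_le_one_left (Real.exp_pos _).le measureReal_le_one
  rw [measureReal_def, tilted_apply_eq_ofReal_integral, integral_div, ENNReal.toReal_ofReal
    (div_nonneg (integral_nonneg fun x => (Real.exp_pos _).le)
      (integral_nonneg fun x => (Real.exp_pos _).le))]
  calc (∫ x in {x | f x ≤ a}, Real.exp (β * f x) ∂μ) / ∫ x, Real.exp (β * f x) ∂μ
      ≤ Real.exp (β * a) / (Real.exp (β * b) * μ.real {x | b < f x}) := by gcongr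
    _ = Real.exp (-((b - a) * β)) / μ.real {x | b < f x} := by
        rw [← div_div, ← Real.exp_sub]
        ring_nf

/-- Exponential tilting concentrates all the mass above any level below the essential supremum. -/
lemma tendsto_tilted_mul_real_lt_essSup {X : Type*} [MeasurableSpace X] {μ : Measure X}
    [IsProbabilityMeasure μ] {f : X → ℝ} (hf : Measurable f)
    (hbdd : IsCoboundedUnder (· ≤ ·) (ae μ) f)
    (hint : ∀ β : ℝ, Integrable (fun x => Real.exp (β * f x)) μ) {a : ℝ} (ha : a < essSup f μ) :
    Tendsto (fun β : ℝ => (μ.tilted (fun x => β * f x)).real {x | a < f x}) atTop (nhds 1) := by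
  obtain ⟨b, hab, hb⟩ := exists_between ha
  have hpos : 0 < μ.real {x | b < f x} := by
    refine ENNReal.toReal_pos (fun h0 => hb.not_ge ?_) (measure_ne_top _ _)
    refine essSup_le_of_ae_le b ?_ hbdd
    rw [EventuallyLE, ae_iff]
    simpa using h0
  have hlim : Tendsto (fun β : ℝ => 1 - Real.exp (-((b - a) * β)) / μ.real {x | b < f x})
      atTop (nhds 1) := by
    have h := Real.tendsto_exp_neg_atTop_nhds_zero.comp
      (tendsto_id.const_mul_atTop (sub_pos.2 hab))
    simpa using (h.div_const (μ.real {x | b < f x})).const_sub 1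
  refine tendsto_of_tendsto_of_tendsto_of_le_of_le' hlim tendsto_const_nhds ?_ ?_
  · filter_upwards [eventually_ge_atTop 0] with β hβ
    have := isProbabilityMeasure_tilted (hint β)
    have hcompl := probReal_compl_eq_one_sub (μ := μ.tilted fun x => β * f x)
      (measurableSet_le hf (measurable_const (a := a)))
    have hset : {x | f x ≤ a}ᶜ = {x | a < f x} := by ext; simp
    rw [← hset, hcompl]
    exact sub_le_sub_left (tilted_mul_real_le hf hβ (hint β) hpos) 1
  · refine Eventually.of_forall fun β => ?_
    have := isProbabilityMeasure_tilted (hint β)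
    exact measureReal_le_one

/-- For bounded measurable `f` and `τ > 0`, the expectation of `exp(f/τ)` under
the exponentially tilted (hard-negative) distribution `μ_β^f` converges, as
`β → ∞`, to `exp((essSup_μ f)/τ)`. -/
theorem tilted_integral_tendsto_exp_essSup
    {X : Type*} [MeasurableSpace X] (μ : Measure X) [IsProbabilityMeasure μ]
    (f : X → ℝ) (hf : Measurable f) (C : ℝ) (hC : ∀ x, |f x| ≤ C)
    (τ : ℝ) (hτ : 0 < τ) :
    Tendsto
      (fun β : ℝ => ∫ y, Real.exp (f y / τ) ∂(μ.tilted (fun y => β * f y)))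
      atTop (nhds (Real.exp (essSup f μ / τ))) := by
  have hint : ∀ β : ℝ, Integrable (fun x => Real.exp (β * f x)) μ :=
    integrable_exp_mul_of_abs_le hf hC
  have hprob : ∀ β : ℝ, IsProbabilityMeasure (μ.tilted fun x => β * f x) :=
    fun β => isProbabilityMeasure_tilted (hint β)
  have hintτ : ∀ β : ℝ, Integrable (fun x => Real.exp (f x / τ)) (μ.tilted fun x => β * f x) := by
    intro β
    simpa only [div_eq_inv_mul] using integrable_exp_mul_of_abs_le hf hC τ⁻¹
  have hbdd : IsBoundedUnder (· ≤ ·) (ae μ) f :=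
    isBoundedUnder_of ⟨C, fun x => (abs_le.1 (hC x)).2⟩
  have hcobdd : IsCoboundedUnder (· ≤ ·) (ae μ) f :=
    IsBoundedUnder.isCoboundedUnder_le (isBoundedUnder_of ⟨-C, fun x => (abs_le.1 (hC x)).1⟩)
  refine tendsto_order.2 ⟨fun c hc => ?_, fun c hc => Eventually.of_forall fun β => ?_⟩
  · have hcont : Continuous fun t : ℝ => Real.exp (t / τ) := by fun_prop
    obtain ⟨a, hca, ha⟩ := ((((hcont.tendsto (essSup f μ)).eventually_const_lt hc).filter_mono
      nhdsWithin_le_nhds).and (self_mem_nhdsWithin (s := Set.Iio (essSup f μ)))).exists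
    have hlim := (tendsto_tilted_mul_real_lt_essSup hf hcobdd hint ha).const_mul
      (Real.exp (a / τ))
    rw [mul_one] at hlim
    filter_upwards [hlim.eventually_const_lt hca] with β hβ
    refine hβ.trans_le ?_
    calc Real.exp (a / τ) * (μ.tilted fun x => β * f x).real {x | a < f x}
        ≤ ∫ x in {x | a < f x}, Real.exp (f x / τ) ∂(μ.tilted fun x => β * f x) := by
          refine setIntegral_ge_of_const_le_real (measurableSet_lt measurable_const hf)
            (measure_ne_top _ _) (fun x hx => ?_) (hintτ β).integrableOn
          have hx' : a ≤ f x := le_of_lt hx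
          gcongr
      _ ≤ ∫ x, Real.exp (f x / τ) ∂(μ.tilted fun x => β * f x) :=
          setIntegral_le_integral (hintτ β) (ae_of_all _ fun x => (Real.exp_pos _).le)
  · refine lt_of_le_of_lt ?_ hc
    calc ∫ x, Real.exp (f x / τ) ∂(μ.tilted fun x => β * f x)
        ≤ ∫ _, Real.exp (essSup f μ / τ) ∂(μ.tilted fun x => β * f x) := by
          refine integral_mono_ae (hintτ β) (integrable_const _) ?_
          filter_upwards [(tilted_absolutelyContinuous μ fun x => β * f x).ae_le
            (ae_le_essSup hbdd)] with x hx
          gcongr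
      _ = Real.exp (essSup f μ / τ) := by simp
end

section
/- Let f : X → ℝ be bounded measurable and τ > 0. Then β ↦ ∫ exp(f/τ) dμ_β^f is nondecreasing on [0, ∞): tilting with a larger concentration parameter β places at least as much mass on hard negatives. -/
open MeasureTheory Filter

lemma exp_mul_add_exp_mul_le_of_le (x y : ℝ) {a b s : ℝ} (hab : a ≤ b) (hs : 0 ≤ s) :
    Real.exp ((a + s) * x) * Real.exp (b * y) + Real.exp (b * x) * Real.exp ((a + s) * y) ≤
      Real.exp ((b + s) * x) * Real.exp (a * y) + Real.exp (a * x) * Real.exp ((b + s) * y) := by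
  have hmono : ∀ {c : ℝ}, 0 ≤ c → Monotone fun u : ℝ => Real.exp (c * u) := fun hc _ _ h =>
    Real.exp_le_exp.2 (mul_le_mul_of_nonneg_left h hc)
  have key : 0 ≤ (Real.exp ((b - a) * x) - Real.exp ((b - a) * y)) *
      (Real.exp (s * x) - Real.exp (s * y)) := by
    rcases le_total x y with h | h
    · exact mul_nonneg_of_nonpos_of_nonpos (sub_nonpos.2 (hmono (sub_nonneg.2 hab) h))
        (sub_nonpos.2 (hmono hs h))
    · exact mul_nonneg (sub_nonneg.2 (hmono (sub_nonneg.2 hab) h)) (sub_nonneg.2 (hmono hs h))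
  have hb : ∀ u : ℝ, Real.exp (b * u) = Real.exp (a * u) * Real.exp ((b - a) * u) := fun u => by
    rw [← Real.exp_add]; ring_nf
  have := mul_nonneg (mul_nonneg (Real.exp_nonneg (a * x)) (Real.exp_nonneg (a * y))) key
  simp only [add_mul, Real.exp_add, hb]
  linarith

lemma ProbabilityTheory.mgf_add_mul_mgf_le {Ω : Type*} [MeasurableSpace Ω] {μ : Measure Ω}
    [SFinite μ] {X : Ω → ℝ} (hX : ∀ t : ℝ, Integrable (fun ω => Real.exp (t * X ω)) μ)
    {a b s : ℝ} (hab : a ≤ b) (hs : 0 ≤ s) :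
    mgf X μ (a + s) * mgf X μ b ≤ mgf X μ (b + s) * mgf X μ a := by
  have hint : ∀ t u : ℝ,
      Integrable (fun z : Ω × Ω => Real.exp (t * X z.1) * Real.exp (u * X z.2)) (μ.prod μ) :=
    fun t u => (hX t).mul_prod (hX u)
  have hprod : ∀ t u : ℝ, ∫ z : Ω × Ω, Real.exp (t * X z.1) * Real.exp (u * X z.2) ∂(μ.prod μ) =
      mgf X μ t * mgf X μ u := fun t u =>
    integral_prod_mul (fun ω => Real.exp (t * X ω)) fun ω => Real.exp (u * X ω)
  have h := integral_mono ((hint (a + s) b).add (hint b (a + s)))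
    ((hint (b + s) a).add (hint a (b + s)))
    fun z => exp_mul_add_exp_mul_le_of_le (X z.1) (X z.2) hab hs
  rw [integral_add' (hint _ _) (hint _ _), integral_add' (hint _ _) (hint _ _)] at h
  simp only [hprod] at h
  linarith

/-- For bounded measurable `f` and `τ > 0`, the map
`β ↦ ∫ exp(f/τ) dμ_β^f` is nondecreasing on `[0, ∞)`: tilting with a larger
concentration parameter `β` places at least as much mass on hard negatives. -/
theorem tilted_integral_monotone_in_beta
    {X : Type*} [MeasurableSpace X] (μ : Measure X) [IsProbabilityMeasure μ]
    (f : X → ℝ) (hf : Measurable f) (C : ℝ) (hC : ∀ x, |f x| ≤ C)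
    (τ : ℝ) (hτ : 0 < τ) :
    MonotoneOn
      (fun β : ℝ => ∫ y, Real.exp (f y / τ) ∂(μ.tilted (fun y => β * f y)))
      (Set.Ici (0 : ℝ)) := by
  have hint : ∀ t : ℝ, Integrable (fun x => Real.exp (t * f x)) μ := fun t =>
    ProbabilityTheory.integrable_exp_mul_of_mem_Icc hf.aemeasurable
      (ae_of_all _ fun x => abs_le.1 (hC x))
  have hratio : ∀ β : ℝ, ∫ y, Real.exp (f y / τ) ∂(μ.tilted (fun y => β * f y)) =
      ProbabilityTheory.mgf f μ (β + τ⁻¹) / ProbabilityTheory.mgf f μ β := fun β => by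
    rw [integral_exp_tilted]
    simp only [ProbabilityTheory.mgf, Pi.add_apply, add_mul, div_eq_inv_mul]
  intro a _ b _ hab
  simp only [hratio]
  rw [div_le_div_iff₀ (ProbabilityTheory.mgf_pos (hint a)) (ProbabilityTheory.mgf_pos (hint b))]
  exact ProbabilityTheory.mgf_add_mul_mgf_le hint hab (inv_nonneg.2 hτ.le)
end

section
/- Let f : X → ℝ be bounded measurable, τ > 0, Q > 0 and c ∈ ℝ. For a probability measure q on X define the contrastive loss ℓ(q) = −log( exp(c/τ) / ( exp(c/τ) + Q·∫ exp(f/τ) dq ) ). Then the supremum of ℓ(q) over all probability measures q absolutely continuous with respect to μ equals −log( exp(c/τ) / ( exp(c/τ) + Q·exp((essSup_μ f)/τ) ) ). -/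
open MeasureTheory Filter

namespace ContrastiveLoss

/-- The contrastive loss as a function of the mean exponential similarity is monotone. -/
lemma neg_log_div_add_mul_le {E Q s t : ℝ} (hE : 0 < E) (hQ : 0 < Q) (hs : 0 ≤ s)
    (hst : s ≤ t) :
    - Real.log (E / (E + Q * s)) ≤ - Real.log (E / (E + Q * t)) := by
  have ht : 0 ≤ t := hs.trans hst
  apply neg_le_neg
  apply Real.log_le_log (by positivity)
  gcongr

variable {X : Type*} [MeasurableSpace X] {f : X → ℝ} {C τ : ℝ}

lemma integrable_exp_div (hf : Measurable f) (hC : ∀ x, |f x| ≤ C) (hτ : 0 < τ)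
    (q : Measure X) [IsFiniteMeasure q] : Integrable (fun y => Real.exp (f y / τ)) q := by
  refine Integrable.of_bound (by fun_prop) (Real.exp (C / τ)) (Eventually.of_forall fun y => ?_)
  rw [Real.norm_eq_abs, Real.abs_exp]
  have := (abs_le.mp (hC y)).2
  gcongr

lemma integral_exp_div_le_of_ae_le {M : ℝ} (hf : Measurable f) (hC : ∀ x, |f x| ≤ C)
    (hτ : 0 < τ) (q : Measure X) [IsProbabilityMeasure q] (h : ∀ᵐ y ∂q, f y ≤ M) :
    ∫ y, Real.exp (f y / τ) ∂q ≤ Real.exp (M / τ) := by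
  calc ∫ y, Real.exp (f y / τ) ∂q ≤ ∫ _, Real.exp (M / τ) ∂q := by
        refine integral_mono_ae (integrable_exp_div hf hC hτ q) (integrable_const _) ?_
        filter_upwards [h] with y hy
        gcongr
    _ = Real.exp (M / τ) := by simp

lemma le_integral_exp_div_of_ae_le {a : ℝ} (hf : Measurable f) (hC : ∀ x, |f x| ≤ C)
    (hτ : 0 < τ) (q : Measure X) [IsProbabilityMeasure q] (h : ∀ᵐ y ∂q, a ≤ f y) :
    Real.exp (a / τ) ≤ ∫ y, Real.exp (f y / τ) ∂q := by
  calc Real.exp (a / τ) = ∫ _, Real.exp (a / τ) ∂q := by simp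
    _ ≤ ∫ y, Real.exp (f y / τ) ∂q := by
        refine integral_mono_ae (integrable_const _) (integrable_exp_div hf hC hτ q) ?_
        filter_upwards [h] with y hy
        gcongr

lemma measure_lt_ne_zero_of_lt_essSup {a : ℝ} (μ : Measure X) [IsProbabilityMeasure μ]
    (hC : ∀ x, |f x| ≤ C) (ha : a < essSup f μ) : μ {x | a < f x} ≠ 0 := by
  intro h0
  have hle : ∀ᵐ x ∂μ, f x ≤ a := by simpa [ae_iff] using h0
  have hbdd : IsBoundedUnder (· ≥ ·) (ae μ) f :=
    isBoundedUnder_of ⟨-C, fun x => (abs_le.mp (hC x)).1⟩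
  exact ha.not_ge (limsup_le_of_le hbdd.isCoboundedUnder_le hle)

/-- Conditioning on a superlevel set gives absolutely continuous probability measures carried by
points where `f` is nearly its essential supremum. -/
lemma exists_ac_isProbabilityMeasure_ae_le {a : ℝ} (μ : Measure X) [IsProbabilityMeasure μ]
    (hf : Measurable f) (hC : ∀ x, |f x| ≤ C) (ha : a < essSup f μ) :
    ∃ q : Measure X, IsProbabilityMeasure q ∧ q ≪ μ ∧ ∀ᵐ y ∂q, a ≤ f y := by
  have hS := measure_lt_ne_zero_of_lt_essSup μ hC ha
  refine ⟨ProbabilityTheory.cond μ {x | a < f x}, ProbabilityTheory.cond_isProbabilityMeasure hS,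
    ProbabilityTheory.cond_absolutelyContinuous, ?_⟩
  filter_upwards [ProbabilityTheory.ae_cond_mem (measurableSet_lt measurable_const hf)] with y hy
  exact le_of_lt hy

end ContrastiveLoss

/-- For bounded measurable `f`, `τ > 0`, `Q > 0` and `c ∈ ℝ`, the supremum of
the contrastive loss `ℓ(q) = −log(exp(c/τ)/(exp(c/τ) + Q·∫ exp(f/τ) dq))` over
all probability measures `q ≪ μ` equals
`−log(exp(c/τ)/(exp(c/τ) + Q·exp((essSup_μ f)/τ)))`. -/
theorem sSup_contrastive_loss_over_ac_prob_measures
    {X : Type*} [MeasurableSpace X] (μ : Measure X) [IsProbabilityMeasure μ]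
    (f : X → ℝ) (hf : Measurable f) (C : ℝ) (hC : ∀ x, |f x| ≤ C)
    (τ Q c : ℝ) (hτ : 0 < τ) (hQ : 0 < Q) :
    sSup {r : ℝ | ∃ q : Measure X, IsProbabilityMeasure q ∧ q ≪ μ ∧
        r = - Real.log (Real.exp (c / τ) /
              (Real.exp (c / τ) + Q * ∫ y, Real.exp (f y / τ) ∂q))} =
      - Real.log (Real.exp (c / τ) /
          (Real.exp (c / τ) + Q * Real.exp (essSup f μ / τ))) := by
  have hE : 0 < Real.exp (c / τ) := Real.exp_pos _
  refine csSup_eq_of_forall_le_of_forall_lt_exists_gt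
    ⟨_, μ, inferInstance, Measure.AbsolutelyContinuous.rfl, rfl⟩ ?_ ?_
  · rintro r ⟨q, hq, hqμ, rfl⟩
    have hbdd : IsBoundedUnder (· ≤ ·) (ae μ) f :=
      isBoundedUnder_of ⟨C, fun x => (abs_le.mp (hC x)).2⟩
    exact ContrastiveLoss.neg_log_div_add_mul_le hE hQ
      (integral_nonneg fun y => (Real.exp_pos _).le)
      (ContrastiveLoss.integral_exp_div_le_of_ae_le hf hC hτ q (hqμ.ae_le (ae_le_essSup hbdd)))
  · intro w hw
    have hcont : Continuous fun a : ℝ =>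
        - Real.log (Real.exp (c / τ) / (Real.exp (c / τ) + Q * Real.exp (a / τ))) := by
      have hpos : ∀ a : ℝ, 0 < Real.exp (c / τ) + Q * Real.exp (a / τ) := fun a => by positivity
      refine (Continuous.log (Continuous.div (by fun_prop) (by fun_prop) fun a => (hpos a).ne')
        fun a => (div_pos hE (hpos a)).ne').neg
    have hnear := nhdsWithin_le_nhds (s := Set.Iio (essSup f μ))
      (hcont.continuousAt.eventually (lt_mem_nhds hw))
    obtain ⟨a, hwa, ha⟩ := (Eventually.and hnear self_mem_nhdsWithin).exists
    obtain ⟨q, hq, hqμ, haf⟩ := ContrastiveLoss.exists_ac_isProbabilityMeasure_ae_le μ hf hC ha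
    exact ⟨_, ⟨q, hq, hqμ, rfl⟩, hwa.trans_le
      (ContrastiveLoss.neg_log_div_add_mul_le hE hQ (Real.exp_pos _).le
        (ContrastiveLoss.le_integral_exp_div_of_ae_le hf hC hτ q haf))⟩
end

section
/- (Pointwise form of the paper's Proposition.) Let f : X → ℝ be bounded measurable, τ > 0, Q > 0 and c ∈ ℝ, and define ℓ(q) = −log( exp(c/τ) / ( exp(c/τ) + Q·∫ exp(f/τ) dq ) ) for probability measures q on X. Then, with μ_β^f the tilted measure, ℓ(μ_β^f) → sup_{q ≪ μ} ℓ(q) as β → ∞, where the supremum is over probability measures q absolutely continuous with respect to μ: the loss under the hard-negative sampling distribution converges to the supremum of the loss over all admissible negative-sampling distributions. -/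
open MeasureTheory Filter

/-- The normalising constant of the measure tilted by `β * f` is at least
`exp (β * b) * μ {b ≤ f}`. -/
lemma exp_mul_measureReal_le_integral_exp {X : Type*} [MeasurableSpace X] {μ : Measure X}
    {f : X → ℝ} {b β : ℝ} (hβ : 0 ≤ β) (hint : Integrable (fun x => Real.exp (β * f x)) μ)
    [IsFiniteMeasure μ] :
    Real.exp (β * b) * μ.real {x | b ≤ f x} ≤ ∫ x, Real.exp (β * f x) ∂μ := by
  refine le_trans ?_ (mul_meas_ge_le_integral_of_nonneg
    (ae_of_all _ fun x => (Real.exp_pos _).le) hint (Real.exp (β * b)))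
  gcongr ?_ * ?_
  refine measureReal_mono fun x hx => ?_
  exact Real.exp_le_exp.2 (mul_le_mul_of_nonneg_left hx hβ)

/-- If `q ≪ μ` then a monotone function of `f` has `q`-mean at most its value at `essSup f μ`. -/
lemma integral_comp_le_of_absolutelyContinuous {X : Type*} [MeasurableSpace X] {μ q : Measure X}
    [IsProbabilityMeasure q] (hq : q ≪ μ) {f : X → ℝ} {C : ℝ} (hC : ∀ x, |f x| ≤ C)
    {φ : ℝ → ℝ} (hφ : Monotone φ) (hint : Integrable (fun x => φ (f x)) q) :
    ∫ x, φ (f x) ∂q ≤ φ (essSup f μ) := by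
  have hle : ∀ᵐ x ∂q, f x ≤ essSup f μ :=
    hq.ae_le (ae_le_essSup (isBoundedUnder_of ⟨C, fun x => (abs_le.1 (hC x)).2⟩))
  calc ∫ x, φ (f x) ∂q ≤ ∫ _, φ (essSup f μ) ∂q :=
        integral_mono_ae hint (integrable_const _) (hle.mono fun x hx => hφ hx)
    _ = φ (essSup f μ) := by simp

/-- A lower bound for the mean of a nonnegative monotone function of `f` under the measure tilted
by `β * f`, which tends to `φ a` as `β → ∞` if `a < b` and `μ {b ≤ f}` is positive. -/
lemma le_integral_comp_tilted {X : Type*} [MeasurableSpace X] {μ : Measure X}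
    [IsProbabilityMeasure μ] {f : X → ℝ} (hf : Measurable f) {C : ℝ} (hC : ∀ x, |f x| ≤ C)
    {φ : ℝ → ℝ} (hφ : Monotone φ) (hφ0 : ∀ t, 0 ≤ φ t) {a b β : ℝ} (hβ : 0 ≤ β)
    (hb : 0 < μ.real {x | b ≤ f x}) :
    φ a * (1 - Real.exp (β * (a - b)) / μ.real {x | b ≤ f x}) ≤
      ∫ x, φ (f x) ∂(μ.tilted fun x => β * f x) := by
  have hint := integrable_exp_mul_of_abs_le (μ := μ) hf hC β
  have hZ := exp_mul_measureReal_le_integral_exp (b := b) hβ hint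
  have hintφ : Integrable (fun x => Real.exp (β * f x) * φ (f x)) μ := by
    refine hint.mul_bdd (c := φ C)
      (hφ.measurable.comp hf).aestronglyMeasurable (ae_of_all _ fun x => ?_)
    rw [Real.norm_eq_abs, abs_of_nonneg (hφ0 _)]
    exact hφ (abs_le.1 (hC x)).2
  have hpoint : ∀ x, φ a * (Real.exp (β * f x) - Real.exp (β * a)) ≤
      Real.exp (β * f x) * φ (f x) := by
    intro x
    rcases le_total a (f x) with h | h
    · nlinarith [hφ h, hφ0 a, Real.exp_pos (β * f x), Real.exp_pos (β * a),
        mul_nonneg (hφ0 a) (Real.exp_pos (β * a)).le]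
    · have : Real.exp (β * f x) ≤ Real.exp (β * a) :=
        Real.exp_le_exp.2 (mul_le_mul_of_nonneg_left h hβ)
      nlinarith [hφ0 a, mul_nonneg (Real.exp_pos (β * f x)).le (hφ0 (f x))]
  have hmono : φ a * ((∫ x, Real.exp (β * f x) ∂μ) - Real.exp (β * a)) ≤
      ∫ x, Real.exp (β * f x) * φ (f x) ∂μ := by
    have h := integral_mono ((hint.sub (integrable_const (Real.exp (β * a)))).const_mul (φ a))
      hintφ hpoint
    simpa [integral_const_mul, integral_sub hint (integrable_const _)] using h
  set Z := ∫ x, Real.exp (β * f x) ∂μ with hZdef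
  set p := μ.real {x | b ≤ f x}
  have hZpos : 0 < Z := lt_of_lt_of_le (mul_pos (Real.exp_pos _) hb) hZ
  have htilt : ∫ x, φ (f x) ∂(μ.tilted fun x => β * f x) =
      (∫ x, Real.exp (β * f x) * φ (f x) ∂μ) / Z := by
    rw [integral_tilted, ← integral_div]
    refine integral_congr_ae (ae_of_all _ fun x => ?_)
    simp only [smul_eq_mul, ← hZdef]
    ring
  rw [htilt, le_div_iff₀ hZpos]
  refine le_trans ?_ hmono
  rw [mul_assoc]
  refine mul_le_mul_of_nonneg_left ?_ (hφ0 a)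
  have hexp : Real.exp (β * (a - b)) * Real.exp (β * b) = Real.exp (β * a) := by
    rw [← Real.exp_add]; ring_nf
  have : Real.exp (β * a) ≤ Real.exp (β * (a - b)) / p * Z := by
    rw [div_mul_eq_mul_div, le_div_iff₀ hb, ← hexp, mul_assoc]
    gcongr
  linarith

/-- As `β → ∞`, the measures tilted by `β * f` concentrate where `f` is close to its essential
supremum. -/
lemma tendsto_integral_comp_tilted {X : Type*} [MeasurableSpace X] (μ : Measure X)
    [IsProbabilityMeasure μ] {f : X → ℝ} (hf : Measurable f) {C : ℝ} (hC : ∀ x, |f x| ≤ C)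
    {φ : ℝ → ℝ} (hφ : Monotone φ) (hφ0 : ∀ t, 0 ≤ φ t) (hcont : Continuous φ) :
    Tendsto (fun β : ℝ => ∫ x, φ (f x) ∂(μ.tilted fun x => β * f x)) atTop
      (nhds (φ (essSup f μ))) := by
  have hprob : ∀ β : ℝ, IsProbabilityMeasure (μ.tilted fun x => β * f x) := fun β =>
    isProbabilityMeasure_tilted (integrable_exp_mul_of_abs_le hf hC β)
  refine tendsto_order.2 ⟨fun y hy => ?_, fun y hy => Eventually.of_forall fun β => ?_⟩
  · obtain ⟨a, hya, ha⟩ : ∃ a, y < φ a ∧ a < essSup f μ := by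
      have h : ∀ᶠ a in nhdsWithin (essSup f μ) (Set.Iio (essSup f μ)), y < φ a :=
        nhdsWithin_le_nhds ((hcont.tendsto _).eventually (lt_mem_nhds hy))
      exact (h.and self_mem_nhdsWithin).exists
    obtain ⟨b, hab, hb⟩ := exists_between ha
    have hp : 0 < μ.real {x | b ≤ f x} := by
      refine measureReal_nonneg.lt_of_ne' fun h0 => hb.not_ge ?_
      have hbdd : IsBoundedUnder (· ≥ ·) (ae μ) f :=
        isBoundedUnder_of ⟨-C, fun x => (abs_le.1 (hC x)).1⟩
      have hnull : ∀ᵐ x ∂μ, ¬ b ≤ f x :=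
        measure_eq_zero_iff_ae_notMem.1 ((measureReal_eq_zero_iff).1 h0)
      exact essSup_le_of_ae_le b (hnull.mono fun x hx => (not_le.1 hx).le)
        hbdd.isCoboundedUnder_le
    have hlim : Tendsto (fun β : ℝ =>
        φ a * (1 - Real.exp (β * (a - b)) / μ.real {x | b ≤ f x})) atTop (nhds (φ a)) := by
      have h1 : Tendsto (fun β : ℝ => Real.exp (β * (a - b))) atTop (nhds 0) :=
        Real.tendsto_exp_atBot.comp (tendsto_id.atTop_mul_const_of_neg (sub_neg.2 hab))
      simpa using ((h1.div_const (μ.real {x | b ≤ f x})).const_sub 1).const_mul (φ a)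
    filter_upwards [hlim.eventually (lt_mem_nhds hya), eventually_ge_atTop 0] with β h1 h2
    exact h1.trans_le (le_integral_comp_tilted hf hC hφ hφ0 h2 hp)
  · have := hprob β
    refine (integral_comp_le_of_absolutelyContinuous (tilted_absolutelyContinuous _ _) hC hφ
      ?_).trans_lt hy
    refine Integrable.of_bound (by fun_prop) (φ C) (ae_of_all _ fun x => ?_)
    rw [Real.norm_eq_abs, abs_of_nonneg (hφ0 _)]
    exact hφ (abs_le.1 (hC x)).2

lemma monotoneOn_neg_log_div_add_mul {A Q : ℝ} (hA : 0 < A) (hQ : 0 < Q) :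
    MonotoneOn (fun t => -Real.log (A / (A + Q * t))) (Set.Ici 0) := by
  intro s hs t _ hst
  have hs0 : 0 ≤ Q * s := mul_nonneg hQ.le hs
  have hst' : Q * s ≤ Q * t := mul_le_mul_of_nonneg_left hst hQ.le
  have hApos : 0 < A + Q * t := by linarith
  simp only [neg_le_neg_iff]
  refine Real.log_le_log (by positivity) ?_
  gcongr

/-- Pointwise form of the paper's Proposition: with
`ℓ(q) = −log(exp(c/τ)/(exp(c/τ) + Q·∫ exp(f/τ) dq))`, the loss under the
hard-negative (tilted) sampling distribution `μ_β^f` converges, as `β → ∞`, to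
the supremum of `ℓ(q)` over all probability measures `q ≪ μ`. -/
theorem contrastive_loss_tilted_tendsto_sSup
    {X : Type*} [MeasurableSpace X] (μ : Measure X) [IsProbabilityMeasure μ]
    (f : X → ℝ) (hf : Measurable f) (C : ℝ) (hC : ∀ x, |f x| ≤ C)
    (τ Q c : ℝ) (hτ : 0 < τ) (hQ : 0 < Q) :
    Tendsto
      (fun β : ℝ =>
        - Real.log (Real.exp (c / τ) /
            (Real.exp (c / τ) +
              Q * ∫ y, Real.exp (f y / τ) ∂(μ.tilted (fun y => β * f y)))))
      atTop
      (nhds (sSup {r : ℝ | ∃ q : Measure X, IsProbabilityMeasure q ∧ q ≪ μ ∧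
        r = - Real.log (Real.exp (c / τ) /
              (Real.exp (c / τ) + Q * ∫ y, Real.exp (f y / τ) ∂q))})) := by
  have hφ : Monotone fun t : ℝ => Real.exp (t / τ) := fun s t h =>
    Real.exp_le_exp.2 (div_le_div_of_nonneg_right h hτ.le)
  have hA := Real.exp_pos (c / τ)
  have hlim : Tendsto
      (fun β : ℝ =>
        - Real.log (Real.exp (c / τ) /
            (Real.exp (c / τ) +
              Q * ∫ y, Real.exp (f y / τ) ∂(μ.tilted (fun y => β * f y)))))
      atTop (nhds (- Real.log (Real.exp (c / τ) /
            (Real.exp (c / τ) + Q * Real.exp (essSup f μ / τ))))) := by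
    have h := tendsto_integral_comp_tilted μ hf hC hφ (fun t => (Real.exp_pos _).le) (by fun_prop)
    have hB := Real.exp_pos (essSup f μ / τ)
    exact ((tendsto_const_nhds.div ((h.const_mul Q).const_add _) (by positivity)).log
      (by positivity)).neg
  have hlub : IsLUB {r : ℝ | ∃ q : Measure X, IsProbabilityMeasure q ∧ q ≪ μ ∧
        r = - Real.log (Real.exp (c / τ) /
              (Real.exp (c / τ) + Q * ∫ y, Real.exp (f y / τ) ∂q))}
      (- Real.log (Real.exp (c / τ) /
            (Real.exp (c / τ) + Q * Real.exp (essSup f μ / τ)))) := by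
    refine ⟨?_, fun u hu => le_of_tendsto' hlim fun β => hu ⟨_, ?_,
      tilted_absolutelyContinuous _ _, rfl⟩⟩
    · rintro _ ⟨q, _, hqμ, rfl⟩
      refine monotoneOn_neg_log_div_add_mul hA hQ
        (Set.mem_Ici.2 (integral_nonneg fun x => (Real.exp_pos _).le)) (Real.exp_pos _).le
        (integral_comp_le_of_absolutelyContinuous hqμ hC hφ ?_)
      simpa only [div_eq_inv_mul] using integrable_exp_mul_of_abs_le hf hC τ⁻¹
    · exact isProbabilityMeasure_tilted (integrable_exp_mul_of_abs_le hf hC β)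
  rw [hlub.csSup_eq hlub.nonempty]
  exact hlim
end
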